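/- arXiv:1203.0910 — 12 statements merged into one kernel-verified Lean document; each statement's English description precedes it below -/
import Mathlib

section
/- Let V be a linear subspace of GF(2)^E. If x ∈ V and y ∈ V ∩ V⊥, then |supp(x+y)| ≡ |supp(x)| + |supp(y)| (mod 4). In particular, if |supp(y)| ≡ 0 (mod 4) for every y ∈ V ∩ V⊥, then |supp(x+y)| ≡ |supp(x)| (mod 4) for all x ∈ V and y ∈ V ∩ V⊥. -/
open Finset

attribute [local instance] Classical.propDecidable

variable {E : Type*}

/-- The support of a vector in `GF(2)^E`, as a `Finset`. -/
def supp [Fintype E] (x : E → ZMod 2) : Finset E :=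
  Finset.univ.filter fun e => x e ≠ 0

/-- The standard bilinear form `⟨x,y⟩ = ∑ e, x e * y e` on `GF(2)^E`. -/
def bilin [Fintype E] (x y : E → ZMod 2) : ZMod 2 := ∑ e, x e * y e

/-- The orthogonal complement of a subspace of `GF(2)^E` w.r.t. `bilin`. -/
def perp [Fintype E] (V : Submodule (ZMod 2) (E → ZMod 2)) :
    Submodule (ZMod 2) (E → ZMod 2) where
  carrier := {w | ∀ v ∈ V, bilin w v = 0}
  zero_mem' := by intro v hv; simp [bilin]
  add_mem' := by
    intro a b ha hb v hv
    have ha' := ha v hv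
    have hb' := hb v hv
    simp only [bilin, Pi.add_apply, add_mul] at *
    rw [Finset.sum_add_distrib, ha', hb', add_zero]
  smul_mem' := by
    intro c a ha v hv
    have ha' := ha v hv
    simp only [bilin, Pi.smul_apply, smul_eq_mul, mul_assoc] at *
    rw [← Finset.mul_sum, ha', mul_zero]

theorem supp_card_eq [Fintype E] (x : E → ZMod 2) :
    (supp x).card = ∑ e, (x e).val := by
  unfold supp
  rw [Finset.card_filter]
  refine Finset.sum_congr rfl fun e _ => ?_
  generalize x e = a
  have ha : a = 0 ∨ a = 1 := by revert a; decide
  rcases ha with rfl | rfl <;> simp [ZMod.val_one]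

theorem val_add_two_mul (a b : ZMod 2) :
    (a + b).val + 2 * (b * a).val = a.val + b.val := by
  revert a b; decide

theorem supp_add_card [Fintype E] (x y : E → ZMod 2) (h : bilin y x = 0) :
    (supp (x + y)).card ≡ (supp x).card + (supp y).card [MOD 4] := by
  have h1 : (supp (x + y)).card + 2 * ∑ e, (y e * x e).val
      = (supp x).card + (supp y).card := by
    simp only [supp_card_eq, Finset.mul_sum, ← Finset.sum_add_distrib]
    exact Finset.sum_congr rfl fun e _ => val_add_two_mul (x e) (y e)
  have h2 : 2 ∣ ∑ e, (y e * x e).val := by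
    rw [← ZMod.natCast_eq_zero_iff]
    rw [Nat.cast_sum]
    simpa only [ZMod.natCast_zmod_val, bilin] using h
  unfold Nat.ModEq
  omega

/-- If `x ∈ V` and `y ∈ V ∩ V⊥`, then `|supp(x+y)| ≡ |supp x| + |supp y| (mod 4)`.
In particular, if `|supp y| ≡ 0 (mod 4)` for every `y ∈ V ∩ V⊥`, then
`|supp(x+y)| ≡ |supp x| (mod 4)` for all `x ∈ V` and `y ∈ V ∩ V⊥`. -/
theorem statement1 [Fintype E] (V : Submodule (ZMod 2) (E → ZMod 2)) :
    (∀ x ∈ V, ∀ y ∈ V ⊓ perp V,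
      (supp (x + y)).card ≡ (supp x).card + (supp y).card [MOD 4]) ∧
    ((∀ y ∈ V ⊓ perp V, (supp y).card ≡ 0 [MOD 4]) →
      ∀ x ∈ V, ∀ y ∈ V ⊓ perp V, (supp (x + y)).card ≡ (supp x).card [MOD 4]) := by
  have key : ∀ x ∈ V, ∀ y ∈ V ⊓ perp V,
      (supp (x + y)).card ≡ (supp x).card + (supp y).card [MOD 4] :=
    fun x hx y hy => supp_add_card x y (hy.2 x hx)
  refine ⟨key, fun h x hx y hy => ?_⟩
  have h1 := key x hx y hy
  have h2 := h y hy
  unfold Nat.ModEq at *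
  omega
end

section
/- Let V be a linear subspace of GF(2)^E. If there exists y ∈ V ∩ V⊥ with |supp(y)| ≡ 2 (mod 4), then ∑_{x ∈ V} i^{|supp(x)|} = 0, where i is the imaginary unit in ℂ and the sum runs over all vectors of the finite subspace V. -/
open Finset

attribute [local instance] Classical.propDecidable

variable {E : Type*}

/-- Inclusion-exclusion for supports of sums over `GF(2)`. -/
theorem card_supp_add [Fintype E] (x y : E → ZMod 2) :
    (supp (x + y)).card + 2 * (supp (fun e => y e * x e)).card
      = (supp x).card + (supp y).card := by
  simp only [supp, Finset.card_filter, Finset.mul_sum, ← Finset.sum_add_distrib]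
  refine Finset.sum_congr rfl fun e _ => ?_
  simp only [Pi.add_apply]
  have key : ∀ a b : ZMod 2, (a = 0 ∨ a = 1) ∧ (b = 0 ∨ b = 1) := by decide
  have h2 : (1 : ZMod 2) + 1 = 0 := by decide
  obtain ⟨ha | ha, hb | hb⟩ := key (x e) (y e) <;> simp [ha, hb, h2]

/-- The bilinear form is the parity of the size of the common support. -/
theorem bilin_eq_card [Fintype E] (x y : E → ZMod 2) :
    bilin y x = ((supp (fun e => y e * x e)).card : ZMod 2) := by
  simp only [supp, bilin, Finset.card_filter, Nat.cast_sum]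
  refine Finset.sum_congr rfl fun e _ => ?_
  have key : ∀ a : ZMod 2, a = 0 ∨ a = 1 := by decide
  rcases key (y e * x e) with h | h <;> simp [h]

/-- If some `y ∈ V ∩ V⊥` has `|supp y| ≡ 2 (mod 4)`, then `∑_{x ∈ V} i^{|supp x|} = 0`. -/
theorem statement2 [Fintype E] (V : Submodule (ZMod 2) (E → ZMod 2))
    (h : ∃ y ∈ V ⊓ perp V, (supp y).card % 4 = 2) :
    ∑ x : ↥V, Complex.I ^ (supp (x : E → ZMod 2)).card = 0 := by
  obtain ⟨y, hy, hc⟩ := h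
  obtain ⟨hyV, hyP⟩ := Submodule.mem_inf.mp hy
  have hneg : ∀ x : V, Complex.I ^ (supp ((x + ⟨y, hyV⟩ : V) : E → ZMod 2)).card
      = - Complex.I ^ (supp (x : E → ZMod 2)).card := by
    intro x
    have h1 := card_supp_add (x : E → ZMod 2) y
    have h2 : bilin y (x : E → ZMod 2) = 0 := hyP x x.2
    rw [bilin_eq_card, ZMod.natCast_eq_zero_iff] at h2
    have h3 : (supp ((x : E → ZMod 2) + y)).card % 4
        = ((supp (x : E → ZMod 2)).card + 2) % 4 := by omega
    rw [Submodule.coe_add, Complex.I_pow_eq_pow_mod, h3, ← Complex.I_pow_eq_pow_mod, pow_add,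
      Complex.I_sq, mul_neg_one]
  have hs := Equiv.sum_comp (Equiv.addRight (⟨y, hyV⟩ : V))
    (fun x : V => Complex.I ^ (supp (x : E → ZMod 2)).card)
  simp only [Equiv.coe_addRight, hneg, Finset.sum_neg_distrib] at hs
  exact self_eq_neg.mp hs.symm
end

section
/- Let V be a linear subspace of GF(2)^E such that |supp(y)| ≡ 0 (mod 4) for every y ∈ V ∩ V⊥, and let W be a linear subspace of V with V = W ⊕ (V ∩ V⊥) (internal direct sum, i.e. W ∩ (V ∩ V⊥) = 0 and W + (V ∩ V⊥) = V). Then ∑_{x ∈ V} i^{|supp(x)|} = 2^{d(V)} · ∑_{w ∈ W} i^{|supp(w)|}, where d(V) := dim(V ∩ V⊥). -/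
open Finset

attribute [local instance] Classical.propDecidable

variable {E : Type*}

theorem card_supp_add_aux [Fintype E] (x y : E → ZMod 2) :
    (supp (x + y)).card + 2 * (supp x ∩ supp y).card = (supp x).card + (supp y).card := by
  have h : supp x ∩ supp y = Finset.univ.filter fun e => x e ≠ 0 ∧ y e ≠ 0 := by
    ext e; simp [supp]
  rw [h]
  simp only [supp, Finset.card_filter, Finset.mul_sum, ← Finset.sum_add_distrib]
  refine Finset.sum_congr rfl fun e _ => ?_
  have key : ∀ a b : ZMod 2, (a = 0 ∧ b = 0 ∧ a + b = 0) ∨ (a = 0 ∧ b ≠ 0 ∧ a + b ≠ 0) ∨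
      (a ≠ 0 ∧ b = 0 ∧ a + b ≠ 0) ∨ (a ≠ 0 ∧ b ≠ 0 ∧ a + b = 0) := by decide
  rcases key (x e) (y e) with ⟨h1, h2, h3⟩ | ⟨h1, h2, h3⟩ | ⟨h1, h2, h3⟩ | ⟨h1, h2, h3⟩ <;>
    simp only [Pi.add_apply, h3] <;> simp [h1, h2]

theorem bilin_eq_card_aux [Fintype E] (x y : E → ZMod 2) :
    bilin x y = ((supp x ∩ supp y).card : ZMod 2) := by
  have h : supp x ∩ supp y = Finset.univ.filter fun e => x e ≠ 0 ∧ y e ≠ 0 := by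
    ext e; simp [supp]
  rw [h, Finset.card_filter, Nat.cast_sum]
  refine Finset.sum_congr rfl fun e _ => ?_
  have key : ∀ a b : ZMod 2, (a = 0 ∧ b = 0) ∨ (a = 0 ∧ b = 1) ∨
      (a = 1 ∧ b = 0) ∨ (a = 1 ∧ b = 1) := by decide
  rcases key (x e) (y e) with ⟨h1, h2⟩ | ⟨h1, h2⟩ | ⟨h1, h2⟩ | ⟨h1, h2⟩ <;>
    simp [h1, h2]

theorem pow_supp_add_aux [Fintype E] (x y : E → ZMod 2) (hb : bilin y x = 0)
    (hy : (supp y).card % 4 = 0) :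
    Complex.I ^ (supp (x + y)).card = Complex.I ^ (supp x).card := by
  have h1 := card_supp_add_aux x y
  rw [bilin_eq_card_aux, ZMod.natCast_eq_zero_iff, Finset.inter_comm] at hb
  rw [Complex.I_pow_eq_pow_mod, Complex.I_pow_eq_pow_mod (supp x).card]
  congr 1
  omega


/-- If `|supp y| ≡ 0 (mod 4)` for every `y ∈ V ∩ V⊥` and `V = W ⊕ (V ∩ V⊥)` internally,
then `∑_{x ∈ V} i^{|supp x|} = 2^{d(V)} ∑_{w ∈ W} i^{|supp w|}`, where
`d(V) = dim (V ∩ V⊥)`. -/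
theorem statement3 [Fintype E] (V W : Submodule (ZMod 2) (E → ZMod 2))
    (h4 : ∀ y ∈ V ⊓ perp V, (supp y).card % 4 = 0)
    (hWV : W ≤ V)
    (hdisj : W ⊓ (V ⊓ perp V) = ⊥)
    (hsum : W ⊔ (V ⊓ perp V) = V) :
    ∑ x : ↥V, Complex.I ^ (supp (x : E → ZMod 2)).card =
      (2 : ℂ) ^ Module.finrank (ZMod 2) ↥(V ⊓ perp V) *
        ∑ w : ↥W, Complex.I ^ (supp (w : E → ZMod 2)).card := by
  have hbij : Function.Bijective (fun p : ↥W × ↥(V ⊓ perp V) =>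
      (⟨(p.1 : E → ZMod 2) + p.2, V.add_mem (hWV p.1.2) p.2.2.1⟩ : ↥V)) := by
    constructor
    · rintro ⟨⟨a, ha⟩, ⟨b, hb⟩⟩ ⟨⟨c, hc⟩, ⟨d, hd⟩⟩ h
      have h' : a + b = c + d := congrArg Subtype.val h
      have e : a - c = d - b := by
        rw [sub_eq_sub_iff_add_eq_add, h', add_comm]
      have hz : a - c ∈ W ⊓ (V ⊓ perp V) :=
        ⟨W.sub_mem ha hc, e ▸ (V ⊓ perp V).sub_mem hd hb⟩
      rw [hdisj, Submodule.mem_bot] at hz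
      have hac : a = c := sub_eq_zero.mp hz
      subst hac
      have hbd : b = d := add_left_cancel h'
      subst hbd
      rfl
    · rintro ⟨x, hx⟩
      have hx' := hx
      rw [← hsum] at hx'
      obtain ⟨w, hw, u, hu, rfl⟩ := Submodule.mem_sup.mp hx'
      exact ⟨(⟨w, hw⟩, ⟨u, hu⟩), rfl⟩
  have hcard : Fintype.card ↥(V ⊓ perp V) =
      2 ^ Module.finrank (ZMod 2) ↥(V ⊓ perp V) := by
    rw [Module.card_eq_pow_finrank (K := ZMod 2), ZMod.card]
  rw [← Function.Bijective.sum_comp hbij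
    (fun x : ↥V => Complex.I ^ (supp (x : E → ZMod 2)).card), Fintype.sum_prod_type,
    Finset.mul_sum]
  refine Finset.sum_congr rfl fun w _ => ?_
  have : ∀ u : ↥(V ⊓ perp V),
      Complex.I ^ (supp ((w : E → ZMod 2) + (u : E → ZMod 2))).card =
        Complex.I ^ (supp (w : E → ZMod 2)).card := fun u =>
    pow_supp_add_aux _ _ (u.2.2 _ (hWV w.2)) (h4 _ u.2)
  simp only [this, Finset.sum_const, Finset.card_univ, nsmul_eq_mul, hcard]
  push_cast
  rfl
end

section
/- Let V be a linear subspace of GF(2)^E and let r(F) := |F| − dim{v ∈ V : supp(v) ⊆ F} for F ⊆ E, and T_V(x,y) := ∑_{F ⊆ E} (x−1)^{r(E)−r(F)} (y−1)^{|F|−r(F)}. Then (Greene's formula at this point) ∑_{x ∈ V} i^{|supp(x)|} = i^{r(E)} · (1−i)^{|E|−r(E)} · T_V(−i, i), as an identity of complex numbers. -/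
open Finset

attribute [local instance] Classical.propDecidable

variable {E : Type*}

/-- The subspace of vectors supported inside `F`. -/
def suppIn [Fintype E] (F : Finset E) : Submodule (ZMod 2) (E → ZMod 2) where
  carrier := {v | ∀ e ∉ F, v e = 0}
  zero_mem' := by intro e _; rfl
  add_mem' := by intro a b ha hb e he; simp [Pi.add_apply, ha e he, hb e he]
  smul_mem' := by intro c a ha e he; simp [Pi.smul_apply, ha e he]

/-- The rank function of the binary matroid `M(V)`:
`r(F) = |F| - dim {v ∈ V : supp v ⊆ F}`. -/
noncomputable def rk [Fintype E] (V : Submodule (ZMod 2) (E → ZMod 2)) (F : Finset E) : ℕ :=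
  F.card - Module.finrank (ZMod 2) ↥(V ⊓ suppIn F)

/-- The Tutte polynomial of the binary matroid `M(V)`, evaluated at `(x,y) ∈ ℂ²`. -/
noncomputable def tutte [Fintype E] (V : Submodule (ZMod 2) (E → ZMod 2)) (x y : ℂ) : ℂ :=
  ∑ F : Finset E,
    (x - 1) ^ (rk V Finset.univ - rk V F) * (y - 1) ^ (F.card - rk V F)

noncomputable def suppInEquiv [Fintype E] (F : Finset E) :
    suppIn F ≃ₗ[ZMod 2] (F → ZMod 2) where
  toFun v := fun e => (v : E → ZMod 2) e
  map_add' _ _ := rfl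
  map_smul' _ _ := rfl
  invFun w := ⟨fun e => if h : e ∈ F then w ⟨e, h⟩ else 0, by
    intro e he
    simp [he]⟩
  left_inv v := by
    ext e
    by_cases h : e ∈ F
    · simp [h]
    · simp [h, v.2 e h]
  right_inv w := by
    ext e
    simp

theorem finrank_suppIn [Fintype E] (F : Finset E) :
    Module.finrank (ZMod 2) (suppIn F) = F.card := by
  rw [(suppInEquiv F).finrank_eq]
  simp

theorem pow_supp_expand [Fintype E] (x : E → ZMod 2) :
    Complex.I ^ (supp x).card = ∑ F : Finset E,
      Complex.I ^ F.card * (if x ∈ suppIn F then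
        (1 - Complex.I) ^ (Fintype.card E - F.card) else 0) := by
  have h := Finset.prod_add (fun _ : E => Complex.I)
    (fun e => if x e = 0 then 1 - Complex.I else 0) Finset.univ
  have h1 : ∏ e : E, (Complex.I + if x e = 0 then 1 - Complex.I else 0) =
      Complex.I ^ (supp x).card := by
    rw [supp, ← Finset.prod_const, Finset.prod_filter]
    refine Finset.prod_congr rfl fun e _ => ?_
    by_cases he : x e = 0 <;> simp [he]
  rw [← h1, h, Finset.powerset_univ]
  refine Finset.sum_congr rfl fun F _ => ?_
  rw [Finset.prod_const]
  congr 1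
  split_ifs with hx
  · have : Fintype.card E - F.card = (Finset.univ \ F).card := by
      rw [← Finset.compl_eq_univ_sdiff, Finset.card_compl]
    rw [this, ← Finset.prod_const]
    refine Finset.prod_congr rfl fun e he => ?_
    rw [if_pos (hx e (Finset.mem_sdiff.1 he).2)]
  · have : ∃ e, e ∉ F ∧ x e ≠ 0 := by
      by_contra hc
      push Not at hc
      exact hx hc
    obtain ⟨e, he, hxe⟩ := this
    exact Finset.prod_eq_zero (i := e) (by simp [he]) (by simp [hxe])

theorem card_inf_suppIn [Fintype E] (V : Submodule (ZMod 2) (E → ZMod 2)) (F : Finset E) (c : ℂ) :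
    ∑ x : ↥V, (if (x : E → ZMod 2) ∈ suppIn F then c else 0) =
      2 ^ Module.finrank (ZMod 2) ↥(V ⊓ suppIn F) * c := by
  rw [← Finset.sum_filter, Finset.sum_const, nsmul_eq_mul]
  congr 1
  have h := Module.card_eq_pow_finrank (K := ZMod 2) (V := ↥(V ⊓ suppIn F))
  rw [ZMod.card] at h
  have h2 : (Finset.univ.filter fun x : V => (x : E → ZMod 2) ∈ suppIn F).card =
      Fintype.card ↥(V ⊓ suppIn F) := by
    rw [← Fintype.card_subtype]
    exact Fintype.card_congr
      { toFun := fun x => ⟨x.1.1, x.1.2, x.2⟩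
        invFun := fun x => ⟨⟨x.1, x.2.1⟩, x.2.2⟩
        left_inv := fun _ => rfl
        right_inv := fun _ => rfl }
  rw [h2, h]
  push_cast
  rfl

/-- Greene's formula at the point `(-i, i)`:
`∑_{x ∈ V} i^{|supp x|} = i^{r(E)} (1-i)^{|E|-r(E)} T_V(-i, i)`. -/
theorem statement4 [Fintype E] (V : Submodule (ZMod 2) (E → ZMod 2)) :
    ∑ x : ↥V, Complex.I ^ (supp (x : E → ZMod 2)).card =
      Complex.I ^ (rk V Finset.univ) *
        (1 - Complex.I) ^ (Fintype.card E - rk V Finset.univ) *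
        tutte V (-Complex.I) Complex.I := by
  have huniv : V ⊓ suppIn (Finset.univ : Finset E) = V := by
    refine inf_eq_left.2 fun v _ e he => ?_
    simp at he
  have hk : Module.finrank (ZMod 2) V ≤ Fintype.card E := by
    have := Submodule.finrank_le V
    simpa using this
  have hrE : rk V Finset.univ = Fintype.card E - Module.finrank (ZMod 2) V := by
    rw [rk, huniv, Finset.card_univ]
  simp_rw [pow_supp_expand]
  rw [Finset.sum_comm, tutte, Finset.mul_sum]
  refine Finset.sum_congr rfl fun F _ => ?_
  rw [← Finset.mul_sum, card_inf_suppIn]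
  have hF : F.card ≤ Fintype.card E := Finset.card_le_univ F
  have hd : Module.finrank (ZMod 2) ↥(V ⊓ suppIn F) ≤ F.card := by
    rw [← finrank_suppIn F]
    exact Submodule.finrank_mono inf_le_right
  have hs := Submodule.finrank_sup_add_finrank_inf_eq V (suppIn F)
  rw [finrank_suppIn] at hs
  have hsup : Module.finrank (ZMod 2) ↥(V ⊔ suppIn F) ≤ Fintype.card E := by
    have := Submodule.finrank_le (V ⊔ suppIn F)
    simpa using this
  have hrF : rk V F = F.card - Module.finrank (ZMod 2) ↥(V ⊓ suppIn F) := rfl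
  generalize Module.finrank (ZMod 2) ↥(V ⊓ suppIn F) = d at *
  generalize Module.finrank (ZMod 2) ↥(V ⊔ suppIn F) = u at *
  generalize Module.finrank (ZMod 2) V = k at *
  generalize rk V F = r at *
  generalize rk V Finset.univ = R at *
  generalize Fintype.card E = n at *
  generalize F.card = f at *
  obtain ⟨s, rfl⟩ : ∃ s, R = r + s := ⟨R - r, by omega⟩
  obtain ⟨m, rfl⟩ : ∃ m, n = f + m := ⟨n - f, by omega⟩
  obtain rfl : f = r + d := by omega
  have e1 : r + s - r = s := by omega
  have e2 : r + d - r = d := by omega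
  have e3 : r + d + m - (r + d) = m := by omega
  have e4 : r + d + m - (r + s) = k := by omega
  rw [e1, e2, e3, e4]
  have hI : Complex.I * Complex.I = -1 := Complex.I_mul_I
  have a1 : Complex.I * (-Complex.I - 1) = 1 - Complex.I := by linear_combination -hI
  have a2 : (1 - Complex.I) * (Complex.I - 1) = Complex.I * 2 := by linear_combination -hI
  calc Complex.I ^ (r + d) * (2 ^ d * (1 - Complex.I) ^ m)
      = Complex.I ^ r * (1 - Complex.I) ^ m * (Complex.I * 2) ^ d := by
        rw [mul_pow, pow_add]; ring
    _ = Complex.I ^ r * (1 - Complex.I) ^ (m + d) * (Complex.I - 1) ^ d := by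
        rw [← a2, mul_pow, pow_add]; ring
    _ = Complex.I ^ r * (1 - Complex.I) ^ k * (Complex.I * (-Complex.I - 1)) ^ s *
          (Complex.I - 1) ^ d := by
        rw [a1, show m + d = k + s by omega, pow_add]; ring
    _ = _ := by rw [mul_pow, pow_add]; ring
end

section
/- Let V be a linear subspace of GF(2)^E and define the Tutte evaluation T_V(−i,i) := ∑_{F ⊆ E} (−i−1)^{r(E)−r(F)} (i−1)^{|F|−r(F)} where r(F) := |F| − dim{v ∈ V : supp(v) ⊆ F}. If there exists y ∈ V ∩ V⊥ with |supp(y)| ≡ 2 (mod 4), then T_V(−i,i) = 0. -/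
open Finset

attribute [local instance] Classical.propDecidable

variable {E : Type*}

lemma aux_finrank_le [Fintype E] (V : Submodule (ZMod 2) (E → ZMod 2)) (F : Finset E) :
    Module.finrank (ZMod 2) ↥(V ⊓ suppIn F) ≤ F.card := by
  have h := LinearMap.finrank_le_finrank_of_injective
    (f := (LinearMap.funLeft (ZMod 2) (ZMod 2) (fun e : F => (e : E))).comp
      (V ⊓ suppIn F).subtype) ?_
  · simpa using h
  · intro a b hab
    ext e
    by_cases he : e ∈ F
    · exact congrFun hab ⟨e, he⟩
    · have h1 : (a : E → ZMod 2) e = 0 := a.2.2 e he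
      have h2 : (b : E → ZMod 2) e = 0 := b.2.2 e he
      rw [h1, h2]

lemma aux_finrank_ge [Fintype E] (V : Submodule (ZMod 2) (E → ZMod 2)) (F : Finset E) :
    Module.finrank (ZMod 2) V ≤ Module.finrank (ZMod 2) ↥(V ⊓ suppIn F) + Fᶜ.card := by
  set g : V →ₗ[ZMod 2] ((Fᶜ : Finset E) → ZMod 2) :=
    (LinearMap.funLeft (ZMod 2) (ZMod 2) (fun e : (Fᶜ : Finset E) => (e : E))).comp
      V.subtype with hg
  have h := LinearMap.finrank_range_add_finrank_ker g
  have h1 : Module.finrank (ZMod 2) (LinearMap.range g) ≤ Fᶜ.card := by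
    have := Submodule.finrank_le (LinearMap.range g)
    rwa [Module.finrank_fintype_fun_eq_card, Fintype.card_coe] at this
  have h2 : Module.finrank (ZMod 2) (LinearMap.ker g) ≤
      Module.finrank (ZMod 2) ↥(V ⊓ suppIn F) := by
    have hk : ∀ x : LinearMap.ker g, ((x : V) : E → ZMod 2) ∈ V ⊓ suppIn F := by
      intro x
      refine ⟨x.1.2, fun e he => ?_⟩
      exact congrFun (LinearMap.mem_ker.1 x.2) ⟨e, by simpa using he⟩
    refine LinearMap.finrank_le_finrank_of_injective
      (f := (V.subtype.comp (LinearMap.ker g).subtype).codRestrict (V ⊓ suppIn F) hk) ?_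
    intro a b hab
    have := congrArg Subtype.val hab
    exact Subtype.ext (Subtype.ext this)
  omega

lemma aux_univ [Fintype E] (V : Submodule (ZMod 2) (E → ZMod 2)) :
    V ⊓ suppIn (Finset.univ : Finset E) = V := by
  refine inf_eq_left.2 fun v _ e he => absurd (Finset.mem_univ e) he

lemma aux_card [Fintype E] (V : Submodule (ZMod 2) (E → ZMod 2)) (F : Finset E) :
    (2 : ℂ) ^ Module.finrank (ZMod 2) ↥(V ⊓ suppIn F) =
      ∑ v : V, if supp (v : E → ZMod 2) ⊆ F then 1 else 0 := by
  have h := Module.card_eq_pow_finrank (K := ZMod 2) (V := ↥(V ⊓ suppIn F))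
  rw [ZMod.card] at h
  rw [Finset.sum_boole]
  have : (2 : ℂ) ^ Module.finrank (ZMod 2) ↥(V ⊓ suppIn F)
    = ((2 ^ Module.finrank (ZMod 2) ↥(V ⊓ suppIn F) : ℕ) : ℂ) := by push_cast; rfl
  rw [this, ← h, ← Fintype.card_subtype]
  congr 1
  have key : ∀ v : E → ZMod 2, supp v ⊆ F ↔ v ∈ suppIn F := by
    intro v
    constructor
    · intro hs e he
      by_contra hne
      exact he (hs (by simp [supp, hne]))
    · intro hs e he
      by_contra hne
      simp only [supp, Finset.mem_filter] at he
      exact he.2 (hs e hne)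
  refine Fintype.card_congr
    { toFun := fun v => ⟨⟨v.1, v.2.1⟩, (key _).2 v.2.2⟩
      invFun := fun v => ⟨v.1.1, v.1.2, (key _).1 v.2⟩
      left_inv := fun _ => rfl
      right_inv := fun _ => rfl }

lemma aux_sum [Fintype E] (S : Finset E) (a : ℂ) :
    ∑ F : Finset E, (if S ⊆ F then a ^ Fᶜ.card else 0) = (a + 1) ^ Sᶜ.card := by
  rw [← Finset.sum_pow_mul_eq_add_pow, ← Finset.sum_filter]
  refine Finset.sum_nbij' (fun F => Fᶜ) (fun F => Fᶜ) ?_ ?_ ?_ ?_ ?_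
  · intro F hF; simpa using hF
  · intro F hF
    have : F ⊆ Sᶜ := by simpa using hF
    simpa using Finset.subset_compl_comm.1 this
  · simp
  · simp
  · simp

lemma aux_tutte [Fintype E] (V : Submodule (ZMod 2) (E → ZMod 2)) :
    (-Complex.I - 1) ^ Module.finrank (ZMod 2) V * tutte V (-Complex.I) Complex.I =
      ∑ v : V, (-Complex.I) ^ (supp (v : E → ZMod 2))ᶜ.card := by
  have hab : (-Complex.I - 1) * (Complex.I - 1) = 2 := by
    linear_combination -Complex.I_mul_I
  have h1 : ∀ F : Finset E, (-Complex.I - 1) ^ Module.finrank (ZMod 2) V *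
      ((-Complex.I - 1) ^ (rk V Finset.univ - rk V F) *
        (Complex.I - 1) ^ (F.card - rk V F)) =
      ∑ v : V, if supp (v : E → ZMod 2) ⊆ F then (-Complex.I - 1) ^ Fᶜ.card else 0 := by
    intro F
    have e0 := aux_finrank_le V F
    have e1 := aux_finrank_ge V F
    have e2 := aux_finrank_le V Finset.univ
    have e3 := Finset.card_add_card_compl F
    rw [← Finset.card_univ] at e3
    rw [aux_univ] at e2
    have k1 : F.card - rk V F = Module.finrank (ZMod 2) ↥(V ⊓ suppIn F) := by
      unfold rk; omega
    have k2 : Module.finrank (ZMod 2) V + (rk V Finset.univ - rk V F) =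
        Fᶜ.card + Module.finrank (ZMod 2) ↥(V ⊓ suppIn F) := by
      unfold rk; rw [aux_univ]; omega
    rw [← mul_assoc, ← pow_add, k1, k2, pow_add, mul_assoc, ← mul_pow, hab, aux_card,
      Finset.mul_sum]
    simp
  unfold tutte
  rw [Finset.mul_sum, Finset.sum_congr rfl (fun F _ => h1 F), Finset.sum_comm]
  refine Finset.sum_congr rfl fun v _ => ?_
  rw [aux_sum]; congr 1; ring

lemma aux_add [Fintype E] (v y : E → ZMod 2) :
    (supp (v + y)).card + 2 * (supp v ∩ supp y).card = (supp v).card + (supp y).card := by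
  have key : ∀ a b : ZMod 2, (if a + b ≠ 0 then 1 else 0) +
      2 * (if a ≠ 0 ∧ b ≠ 0 then 1 else 0) =
      (if a ≠ 0 then 1 else 0) + (if b ≠ 0 then 1 else 0 : ℕ) := by decide
  unfold supp
  rw [← Finset.filter_and]
  simp only [Finset.card_filter, Finset.mul_sum, ← Finset.sum_add_distrib]
  refine Finset.sum_congr rfl fun e _ => ?_
  convert key (v e) (y e)
  rfl

lemma aux_bilin [Fintype E] (v y : E → ZMod 2) (h : bilin y v = 0) :
    Even (supp v ∩ supp y).card := by
  rw [← ZMod.natCast_eq_zero_iff_even, ← h]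
  have key : ∀ a b : ZMod 2, (if a ≠ 0 ∧ b ≠ 0 then 1 else 0) = b * a := by decide
  unfold supp bilin
  rw [← Finset.filter_and, Finset.card_filter]
  push_cast
  refine Finset.sum_congr rfl fun e _ => ?_
  convert key (v e) (y e)

/-- If some `y ∈ V ∩ V⊥` has `|supp y| ≡ 2 (mod 4)`, then `T_V(-i, i) = 0`. -/
theorem statement5 [Fintype E] (V : Submodule (ZMod 2) (E → ZMod 2))
    (h : ∃ y ∈ V ⊓ perp V, (supp y).card % 4 = 2) :
    tutte V (-Complex.I) Complex.I = 0 := by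
  obtain ⟨y, ⟨hyV, hyp⟩, hy⟩ := h
  have hne : (-Complex.I - 1) ^ Module.finrank (ZMod 2) V ≠ 0 := by
    apply pow_ne_zero
    intro h0
    have := congrArg Complex.re h0
    norm_num at this
  refine (mul_eq_zero.1 ?_).resolve_left hne
  rw [aux_tutte]
  have hI2 : (-Complex.I) ^ 2 = -1 := by
    rw [neg_sq, Complex.I_sq]
  have hstep : ∀ v : V, (-Complex.I) ^ (supp ((v + ⟨y, hyV⟩ : V) : E → ZMod 2))ᶜ.card =
      - (-Complex.I) ^ (supp (v : E → ZMod 2))ᶜ.card := by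
    intro v
    obtain ⟨k, hk⟩ := aux_bilin v.1 y (hyp v.1 v.2)
    have h1 := aux_add v.1 y
    have h2 := Finset.card_add_card_compl (supp v.1)
    have h3 := Finset.card_add_card_compl (supp (v.1 + y))
    have h4 : (supp (v.1 + y))ᶜ.card + 2 * (2 * ((supp y).card / 4) + 1) =
      (supp v.1)ᶜ.card + 2 * (2 * k) := by omega
    have h5 := congrArg (fun n => (-Complex.I) ^ n) h4
    simp only [pow_add, pow_mul, hI2] at h5
    norm_num at h5
    change (-Complex.I) ^ (supp (v.1 + y))ᶜ.card = _
    rw [← h5, neg_neg]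
  have hs := Equiv.sum_comp (Equiv.addRight (⟨y, hyV⟩ : V))
    (fun v : V => (-Complex.I) ^ (supp (v : E → ZMod 2))ᶜ.card)
  simp only [Equiv.coe_addRight, hstep, Finset.sum_neg_distrib] at hs
  exact self_eq_neg.1 hs.symm
end

section
/- Let V be a linear subspace of GF(2)^E with a basis v_1, …, v_k that is orthogonal with respect to the form ⟨·,·⟩, i.e. ⟨v_i, v_j⟩ = 0 in GF(2) for all i ≠ j. Then ∑_{x ∈ V} i^{|supp(x)|} = ∏_{j=1}^{k} (1 + i^{|supp(v_j)|}), as complex numbers. -/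
open Finset

attribute [local instance] Classical.propDecidable

variable {E : Type*}

theorem supp_pow_add [Fintype E] (x y : E → ZMod 2) (h : bilin x y = 0) :
    Complex.I ^ (supp (x + y)).card = Complex.I ^ (supp x).card * Complex.I ^ (supp y).card := by
  have two : ∀ a : ZMod 2, a = 0 ∨ a = 1 := by decide
  have hone : (1 : ZMod 2) + 1 = 0 := by decide
  have hc : (supp (x + y)).card + 2 * (supp x ∩ supp y).card
      = (supp x).card + (supp y).card := by
    have h1 : supp (x + y) = (supp x \ supp y) ∪ (supp y \ supp x) := by
      ext e
      rcases two (x e) with hx | hx <;> rcases two (y e) with hy | hy <;>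
        simp [supp, hx, hy, hone]
    have hd : Disjoint (supp x \ supp y) (supp y \ supp x) := by
      rw [Finset.disjoint_left]
      intro a ha hb
      simp only [Finset.mem_sdiff] at ha hb
      exact hb.2 ha.1
    rw [h1, Finset.card_union_of_disjoint hd]
    have h2 := Finset.card_sdiff_add_card_inter (supp x) (supp y)
    have h3 := Finset.card_sdiff_add_card_inter (supp y) (supp x)
    rw [Finset.inter_comm] at h3
    omega
  have he : 2 ∣ (supp x ∩ supp y).card := by
    rw [← ZMod.natCast_eq_zero_iff, ← h, bilin]
    have h4 : supp x ∩ supp y = Finset.univ.filter fun e => x e * y e ≠ 0 := by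
      ext e
      simp [supp]
    rw [h4, Finset.card_filter]
    push_cast
    refine Finset.sum_congr rfl fun e _ => ?_
    rcases two (x e * y e) with hx | hx <;> simp [hx]
  obtain ⟨m, hm⟩ := he
  rw [← pow_add, ← hc, hm, pow_add, ← mul_assoc, pow_mul]
  norm_num [Complex.I_pow_four]

theorem supp_pow_sum [Fintype E] {k : ℕ} (v : Fin k → E → ZMod 2)
    (horth : ∀ i j, i ≠ j → bilin (v i) (v j) = 0) (c : Fin k → ZMod 2) (s : Finset (Fin k)) :
    Complex.I ^ (supp (∑ i ∈ s, c i • v i)).card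
      = ∏ i ∈ s, Complex.I ^ (supp (c i • v i)).card := by
  induction s using Finset.induction_on with
  | empty => simp [supp]
  | insert a s ha ih =>
    rw [Finset.sum_insert ha, Finset.prod_insert ha, supp_pow_add, ih]
    simp only [bilin, Finset.sum_apply, Finset.mul_sum, Pi.smul_apply, smul_eq_mul]
    rw [Finset.sum_comm]
    refine Finset.sum_eq_zero fun i hi => ?_
    have h := horth a i (fun h => ha (h ▸ hi))
    rw [bilin] at h
    calc _ = ∑ e, c a * c i * (v a e * v i e) := Finset.sum_congr rfl fun e _ => by ring
      _ = 0 := by rw [← Finset.mul_sum, h, mul_zero]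

/-- If `v_1, …, v_k` is a basis of `V` that is orthogonal w.r.t. `⟨·,·⟩`
(`⟨v_i, v_j⟩ = 0` for `i ≠ j`), then
`∑_{x ∈ V} i^{|supp x|} = ∏_j (1 + i^{|supp v_j|})`. -/
theorem statement7 [Fintype E] (V : Submodule (ZMod 2) (E → ZMod 2))
    (k : ℕ) (v : Fin k → E → ZMod 2)
    (hli : LinearIndependent (ZMod 2) v)
    (hsp : Submodule.span (ZMod 2) (Set.range v) = V)
    (horth : ∀ i j, i ≠ j → bilin (v i) (v j) = 0) :
    ∑ x : ↥V, Complex.I ^ (supp (x : E → ZMod 2)).card =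
      ∏ j : Fin k, (1 + Complex.I ^ (supp (v j)).card) := by
  subst hsp
  rw [← (Module.Basis.span hli).equivFun.symm.toEquiv.sum_comp]
  have h : ∀ c : Fin k → ZMod 2,
      Complex.I ^ (supp (((Module.Basis.span hli).equivFun.symm.toEquiv c :
        ↥(Submodule.span (ZMod 2) (Set.range v))) : E → ZMod 2)).card
      = ∏ i, Complex.I ^ (supp (c i • v i)).card := by
    intro c
    rw [← supp_pow_sum v horth c]
    simp [Module.Basis.equivFun_symm_apply, Module.Basis.span_apply]
  rw [Finset.sum_congr rfl fun c _ => h c]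
  have h2 : ∀ j, (1 + Complex.I ^ (supp (v j)).card)
      = ∑ a : ZMod 2, Complex.I ^ (supp (a • v j)).card := by
    intro j
    have h0 : supp (0 : E → ZMod 2) = ∅ := by simp [supp]
    have : ∀ f : ZMod 2 → ℂ, ∑ a, f a = f 0 + f 1 := fun f => Fin.sum_univ_two f
    rw [this]
    simp [h0]
  rw [Finset.prod_congr rfl fun j _ => h2 j, Finset.prod_univ_sum, Fintype.piFinset_univ]
end

section
/- Let V be a linear subspace of GF(2)^E with a basis v_1, …, v_{2m} that is alternating with respect to ⟨·,·⟩, i.e. ⟨v_i, v_j⟩ = 1 in GF(2) if {i,j} = {k, k+m} for some k ∈ {1,…,m}, and ⟨v_i, v_j⟩ = 0 otherwise. Then ∑_{x ∈ V} i^{|supp(x)|} = ∏_{k=1}^{m} (1 + i^{|supp(v_k)|} + i^{|supp(v_{k+m})|} − i^{|supp(v_k)| + |supp(v_{k+m})|}), as complex numbers. -/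
open Finset

attribute [local instance] Classical.propDecidable

variable {E : Type*}

/-- `I` to the indicator of `a ≠ 0`. -/
noncomputable def chiI (a : ZMod 2) : ℂ := if a = 0 then 1 else Complex.I

/-- The sign `(-1)^a`. -/
noncomputable def sgnI (a : ZMod 2) : ℂ := if a = 0 then 1 else -1

theorem zmod2_cases (a : ZMod 2) : a = 0 ∨ a = 1 := by
  revert a; decide

theorem chiI_add (a b : ZMod 2) : chiI (a + b) = chiI a * chiI b * sgnI (a * b) := by
  have h2 : (1 + 1 : ZMod 2) = 0 := by decide
  rcases zmod2_cases a with rfl | rfl <;> rcases zmod2_cases b with rfl | rfl <;>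
    simp [chiI, sgnI, h2]

theorem sgnI_add (a b : ZMod 2) : sgnI (a + b) = sgnI a * sgnI b := by
  have h2 : (1 + 1 : ZMod 2) = 0 := by decide
  rcases zmod2_cases a with rfl | rfl <;> rcases zmod2_cases b with rfl | rfl <;>
    simp [sgnI, h2]

theorem sgnI_sum {ι : Type*} (s : Finset ι) (g : ι → ZMod 2) :
    sgnI (∑ e ∈ s, g e) = ∏ e ∈ s, sgnI (g e) := by
  induction s using Finset.induction_on with
  | empty => simp [sgnI]
  | insert a s ha ih => rw [Finset.sum_insert ha, Finset.prod_insert ha, sgnI_add, ih]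

/-- The weight `I ^ |supp x|`. -/
noncomputable def wtI [Fintype E] (x : E → ZMod 2) : ℂ := Complex.I ^ (supp x).card

theorem wtI_eq [Fintype E] (x : E → ZMod 2) : wtI x = ∏ e, chiI (x e) := by
  simp only [wtI, supp, chiI]
  rw [Finset.prod_ite]
  simp

theorem wtI_add [Fintype E] (x y : E → ZMod 2) :
    wtI (x + y) = wtI x * wtI y * sgnI (bilin x y) := by
  simp only [wtI_eq, bilin, sgnI_sum, ← Finset.prod_mul_distrib, Pi.add_apply, chiI_add]

theorem wtI_zero [Fintype E] : wtI (0 : E → ZMod 2) = 1 := by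
  simp [wtI_eq, chiI]

theorem bilin_add_left [Fintype E] (x y z : E → ZMod 2) :
    bilin (x + y) z = bilin x z + bilin y z := by
  simp [bilin, add_mul, Finset.sum_add_distrib]

theorem bilin_add_right [Fintype E] (x y z : E → ZMod 2) :
    bilin z (x + y) = bilin z x + bilin z y := by
  simp [bilin, mul_add, Finset.sum_add_distrib]

theorem bilin_smul_left [Fintype E] (a : ZMod 2) (x z : E → ZMod 2) :
    bilin (a • x) z = a * bilin x z := by
  simp [bilin, Finset.mul_sum, mul_assoc]

theorem bilin_smul_right [Fintype E] (a : ZMod 2) (x z : E → ZMod 2) :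
    bilin z (a • x) = a * bilin z x := by
  simp [bilin, Finset.mul_sum, mul_left_comm]

theorem bilin_sum_right [Fintype E] {ι : Type*} (s : Finset ι) (z : E → ZMod 2)
    (w : ι → E → ZMod 2) : bilin z (∑ k ∈ s, w k) = ∑ k ∈ s, bilin z (w k) := by
  simp only [bilin, Finset.sum_apply, Finset.mul_sum]
  exact Finset.sum_comm

theorem wtI_sum [Fintype E] {ι : Type*} (s : Finset ι) (w : ι → E → ZMod 2)
    (h : ∀ i j, i ≠ j → bilin (w i) (w j) = 0) :
    wtI (∑ k ∈ s, w k) = ∏ k ∈ s, wtI (w k) := by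
  induction s using Finset.induction_on with
  | empty => simp [wtI_zero]
  | insert a s ha ih =>
    rw [Finset.sum_insert ha, Finset.prod_insert ha, wtI_add, ih, bilin_sum_right,
      Finset.sum_eq_zero]
    · simp [sgnI]
    · intro k hk
      exact h a k (by rintro rfl; exact ha hk)

/-- If `v_1, …, v_{2m}` is a basis of `V` that is alternating w.r.t. `⟨·,·⟩`
(`⟨v_i, v_j⟩ = 1` iff `{i,j} = {k, k+m}` for some `k ∈ {1,…,m}`), then
`∑_{x ∈ V} i^{|supp x|}
  = ∏_{k=1}^m (1 + i^{|supp v_k|} + i^{|supp v_{k+m}|} - i^{|supp v_k| + |supp v_{k+m}|})`. -/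
theorem statement8 [Fintype E] (V : Submodule (ZMod 2) (E → ZMod 2))
    (m : ℕ) (v : Fin (m + m) → E → ZMod 2)
    (hli : LinearIndependent (ZMod 2) v)
    (hsp : Submodule.span (ZMod 2) (Set.range v) = V)
    (halt : ∀ i j : Fin (m + m),
      bilin (v i) (v j) =
        if (i : ℕ) + m = (j : ℕ) ∨ (j : ℕ) + m = (i : ℕ) then 1 else 0) :
    ∑ x : ↥V, Complex.I ^ (supp (x : E → ZMod 2)).card =
      ∏ k : Fin m,
        (1 + Complex.I ^ (supp (v (k.castAdd m))).card
           + Complex.I ^ (supp (v (k.addNat m))).card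
           - Complex.I ^ ((supp (v (k.castAdd m))).card + (supp (v (k.addNat m))).card)) := by
  subst hsp
  have hN : ∀ k : Fin m, Fin.natAdd m k = k.addNat m := fun k => Fin.ext (by simp [add_comm])
  have hloc : ∀ k : Fin m,
      (1 + Complex.I ^ (supp (v (k.castAdd m))).card
           + Complex.I ^ (supp (v (k.addNat m))).card
           - Complex.I ^ ((supp (v (k.castAdd m))).card + (supp (v (k.addNat m))).card))
      = ∑ p : ZMod 2 × ZMod 2, wtI (p.1 • v (k.castAdd m) + p.2 • v (k.addNat m)) := by
    intro k
    have hb : bilin (v (k.castAdd m)) (v (k.addNat m)) = 1 := by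
      rw [halt]; simp
    have hl : ∀ x : E → ZMod 2, bilin 0 x = 0 := fun x => by simp [bilin]
    have hr : ∀ x : E → ZMod 2, bilin x 0 = 0 := fun x => by simp [bilin]
    have hu : (Finset.univ : Finset (ZMod 2)) = {0, 1} := by decide
    rw [Fintype.sum_prod_type, hu]
    simp [wtI_add, wtI_zero, hb, hl, hr, sgnI, pow_add]
    simp only [wtI]
    ring
  rw [Finset.prod_congr rfl (fun k _ => hloc k), Finset.prod_univ_sum, Fintype.piFinset_univ]
  let e : (Fin m → ZMod 2 × ZMod 2) ≃ Submodule.span (ZMod 2) (Set.range v) :=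
    ((Equiv.arrowProdEquivProdArrow (Fin m) (fun _ => ZMod 2) (fun _ => ZMod 2)).trans
      (Fin.appendEquiv m m)).trans (Module.Basis.span hli).equivFun.symm.toEquiv
  refine (Fintype.sum_equiv e _ _ ?_).symm
  intro c
  have he : ((e c : Submodule.span (ZMod 2) (Set.range v)) : E → ZMod 2)
      = ∑ k, ((c k).1 • v (k.castAdd m) + (c k).2 • v (k.addNat m)) := by
    simp [e, Module.Basis.equivFun_symm_apply, Module.Basis.span_apply, Fin.sum_univ_add,
      Finset.sum_add_distrib, Fin.appendEquiv]
    refine Finset.sum_congr rfl fun k _ => ?_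
    rw [← hN, Fin.append_right]
  change _ = wtI _
  rw [he, wtI_sum]
  intro i j hij
  have hij' : (i : ℕ) ≠ j := fun h => hij (Fin.ext h)
  have hi := i.2
  have hj := j.2
  simp only [bilin_add_left, bilin_add_right, bilin_smul_left, bilin_smul_right, halt,
    Fin.val_castAdd, Fin.val_addNat]
  rw [if_neg (by omega), if_neg (by omega), if_neg (by omega), if_neg (by omega)]
  simp
end

section
/- Let V be a linear subspace of GF(2)^E and let e ∈ E. Then the bicycle dimension of the contraction V/e differs from that of V by at most one: d(V/e) ∈ {d(V) − 1, d(V), d(V) + 1}. (Equivalently, in the canonical tripartition, F_i = ∅ for all i ∉ {−1, 0, 1}.) -/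
open Finset

attribute [local instance] Classical.propDecidable

variable {E : Type*}

/-- The bicycle dimension `d(V) = dim (V ∩ V⊥)`. -/
noncomputable def bdim [Fintype E] (V : Submodule (ZMod 2) (E → ZMod 2)) : ℕ :=
  Module.finrank (ZMod 2) ↥(V ⊓ perp V)

/-- The contraction `V/e ⊆ GF(2)^{E∖{e}}`: the image of `V` under the restriction map
`v ↦ v|_{E∖{e}}`. -/
def contr [Fintype E] (V : Submodule (ZMod 2) (E → ZMod 2)) (e : E) :
    Submodule (ZMod 2) ({e' : E // e' ≠ e} → ZMod 2) :=
  V.map (LinearMap.funLeft (ZMod 2) (ZMod 2) (fun e' : {e' : E // e' ≠ e} => (e' : E)))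

theorem bilin_split [Fintype E] (e : E) (v w : E → ZMod 2) :
    bilin v w = v e * w e +
      bilin (LinearMap.funLeft (ZMod 2) (ZMod 2) (fun e' : {e' : E // e' ≠ e} => (e' : E)) v)
        (LinearMap.funLeft (ZMod 2) (ZMod 2) (fun e' : {e' : E // e' ≠ e} => (e' : E)) w) := by
  simp only [bilin, LinearMap.funLeft_apply]
  exact Fintype.sum_eq_add_sum_subtype_ne (fun i => v i * w i) e

theorem finrank_le_ker_add_one [Fintype E] (e : E) (S : Submodule (ZMod 2) (E → ZMod 2)) :
    Module.finrank (ZMod 2) S ≤ Module.finrank (ZMod 2)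
      ↥(S ⊓ LinearMap.ker (LinearMap.proj e : (E → ZMod 2) →ₗ[ZMod 2] ZMod 2)) + 1 := by
  have h1 := Submodule.finrank_sup_add_finrank_inf_eq S
    (LinearMap.ker (LinearMap.proj e : (E → ZMod 2) →ₗ[ZMod 2] ZMod 2))
  have h2 := LinearMap.finrank_range_add_finrank_ker
    (LinearMap.proj e : (E → ZMod 2) →ₗ[ZMod 2] ZMod 2)
  have h3 := Submodule.finrank_le
    (LinearMap.range (LinearMap.proj e : (E → ZMod 2) →ₗ[ZMod 2] ZMod 2))
  have h4 := Submodule.finrank_le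
    (S ⊔ LinearMap.ker (LinearMap.proj e : (E → ZMod 2) →ₗ[ZMod 2] ZMod 2))
  rw [Module.finrank_self] at h3
  omega

/-- The bicycle dimension of the contraction `V/e` differs from that of `V` by at most
one: `d(V/e) ∈ {d(V) - 1, d(V), d(V) + 1}`. -/
theorem statement9 [Fintype E] (V : Submodule (ZMod 2) (E → ZMod 2)) (e : E) :
    (bdim (contr V e) : ℤ) = (bdim V : ℤ) - 1 ∨
    (bdim (contr V e) : ℤ) = (bdim V : ℤ) ∨
    (bdim (contr V e) : ℤ) = (bdim V : ℤ) + 1 := by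
  set r := LinearMap.funLeft (ZMod 2) (ZMod 2) (fun e' : {e' : E // e' ≠ e} => (e' : E)) with hr
  set K := LinearMap.ker (LinearMap.proj e : (E → ZMod 2) →ₗ[ZMod 2] ZMod 2) with hK
  have key : ∀ v w, bilin v w = v e * w e + bilin (r v) (r w) := bilin_split e
  have lower : bdim V ≤ bdim (contr V e) + 1 := by
    refine (finrank_le_ker_add_one e (V ⊓ perp V)).trans (Nat.add_le_add_right ?_ 1)
    have hinj : Function.Injective (r.domRestrict ((V ⊓ perp V) ⊓ K)) := by
      rw [injective_iff_map_eq_zero]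
      rintro ⟨v, hv, hve⟩ h
      have hve' : v e = 0 := hve
      apply Subtype.ext
      funext i
      by_cases hi : i = e
      · subst hi
        exact hve'
      · exact congrFun h ⟨i, hi⟩
    rw [← LinearMap.finrank_range_of_inj hinj]
    apply Submodule.finrank_mono
    rintro _ ⟨⟨v, ⟨hvV, hvp⟩, hve⟩, rfl⟩
    have hve' : v e = 0 := hve
    refine ⟨⟨v, hvV, rfl⟩, ?_⟩
    rintro _ ⟨w, hw, rfl⟩
    have h1 : bilin v w = 0 := hvp w hw
    rw [key, hve', zero_mul, zero_add] at h1
    exact h1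
  have upper : bdim (contr V e) ≤ bdim V + 1 := by
    have h1 : contr V e ⊓ perp (contr V e) ≤ (V ⊓ (perp (contr V e)).comap r).map r := by
      rintro _ ⟨⟨v, hv, rfl⟩, hp⟩
      exact ⟨v, ⟨hv, hp⟩, rfl⟩
    refine (Submodule.finrank_mono h1).trans ((Submodule.finrank_map_le r _).trans ?_)
    refine (finrank_le_ker_add_one e _).trans (Nat.add_le_add_right ?_ 1)
    apply Submodule.finrank_mono
    rintro v ⟨⟨hvV, hvp⟩, hve⟩
    have hve' : v e = 0 := hve
    refine ⟨hvV, ?_⟩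
    intro w hw
    have h2 : bilin (r v) (r w) = 0 := hvp (r w) ⟨w, hw, rfl⟩
    rw [key, hve', zero_mul, zero_add, h2]
  omega
end

section
/- Let V be a linear subspace of GF(2)^E with a basis v_1, …, v_{2m} that is alternating with respect to ⟨·,·⟩, i.e. ⟨v_i, v_j⟩ = 1 if {i,j} = {k, k+m} for some k ∈ {1,…,m} and ⟨v_i, v_j⟩ = 0 otherwise (so in particular V ∩ V⊥ = 0). Then d(V/e) = 0 for every e ∈ E. -/
open Finset

attribute [local instance] Classical.propDecidable

variable {E : Type*}

/-- If `v_1, …, v_{2m}` is an alternating basis of `V` w.r.t. `⟨·,·⟩`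
(so in particular `V ∩ V⊥ = 0`), then `d(V/e) = 0` for every `e ∈ E`. -/
theorem statement12 [Fintype E] (V : Submodule (ZMod 2) (E → ZMod 2))
    (m : ℕ) (v : Fin (m + m) → E → ZMod 2)
    (hli : LinearIndependent (ZMod 2) v)
    (hsp : Submodule.span (ZMod 2) (Set.range v) = V)
    (halt : ∀ i j : Fin (m + m),
      bilin (v i) (v j) =
        if (i : ℕ) + m = (j : ℕ) ∨ (j : ℕ) + m = (i : ℕ) then 1 else 0) :
    ∀ e : E, bdim (contr V e) = 0 := by
  intro e
  have hadd : ∀ x y z : E → ZMod 2, bilin (x + y) z = bilin x z + bilin y z := by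
    intro x y z
    simp [bilin, add_mul, Finset.sum_add_distrib]
  have hcomm : ∀ x y : E → ZMod 2, bilin x y = bilin y x := by
    intro x y
    simp [bilin, mul_comm]
  have hsmul : ∀ (c : ZMod 2) (x z : E → ZMod 2), bilin (c • x) z = c * bilin x z := by
    intro c x z
    simp [bilin, mul_assoc, Finset.mul_sum]
  have hself : ∀ x ∈ V, bilin x x = 0 := by
    intro x hx
    rw [← hsp] at hx
    induction hx using Submodule.span_induction with
    | mem x h =>
      obtain ⟨i, rfl⟩ := h
      rw [halt, if_neg]
      have := i.2
      omega
    | zero => simp [bilin]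
    | add x y _ _ hx hy =>
      rw [hadd, hcomm x, hcomm y, hadd, hadd, hx, hy, hcomm y x, zero_add, add_zero]
      exact CharTwo.add_self_eq_zero _
    | smul c x _ hx => rw [hsmul, hcomm, hsmul, hx]; simp
  have hnd : ∀ w ∈ V, (∀ u ∈ V, bilin w u = 0) → w = 0 := by
    intro w hw h
    rw [← hsp] at hw
    obtain ⟨c, rfl⟩ := (Submodule.mem_span_range_iff_exists_fun (ZMod 2)).1 hw
    have hsum : ∀ j, bilin (∑ i, c i • v i) (v j) = ∑ i, c i * bilin (v i) (v j) := by
      intro j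
      simp only [← hsmul]
      let f : (E → ZMod 2) →+ ZMod 2 :=
        { toFun := fun x => bilin x (v j)
          map_zero' := by simp [bilin]
          map_add' := fun x y => hadd x y _ }
      exact map_sum f _ _
    refine Finset.sum_eq_zero fun i _ => ?_
    obtain ⟨j, hj⟩ : ∃ j : Fin (m + m), (i : ℕ) + m = (j : ℕ) ∨ (j : ℕ) + m = (i : ℕ) := by
      have := i.2
      by_cases hi : (i : ℕ) < m
      · exact ⟨⟨i + m, by omega⟩, Or.inl rfl⟩
      · exact ⟨⟨i - m, by omega⟩, Or.inr (by simp only; omega)⟩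
    have h1 := h (v j) (hsp ▸ Submodule.subset_span ⟨j, rfl⟩)
    rw [hsum, Finset.sum_eq_single i, halt, if_pos hj, mul_one] at h1
    · rw [h1, zero_smul]
    · intro k _ hk
      rw [halt, if_neg, mul_zero]
      intro hk'
      apply hk
      ext
      have := i.2
      have := j.2
      have := k.2
      omega
    · simp
  have hbot : contr V e ⊓ perp (contr V e) = ⊥ := by
    rw [eq_bot_iff]
    rintro _ ⟨⟨w, hw, rfl⟩, hp⟩
    have key : ∀ u ∈ V, bilin w u = w e * u e := by
      intro u hu
      have h := hp _ ⟨u, hu, rfl⟩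
      simp only [bilin, LinearMap.funLeft_apply] at h
      unfold bilin
      rw [Fintype.sum_eq_add_sum_subtype_ne _ e]
      have h' : ∑ i : {i : E // i ≠ e}, w i * u i = 0 := by convert h
      rw [h', add_zero]
    have hwe : w e = 0 := by
      have h := key w hw
      rw [hself w hw] at h
      exact mul_self_eq_zero.1 h.symm
    have : w = 0 := hnd w hw fun u hu => by rw [key u hu, hwe, zero_mul]
    simp [this]
  unfold bdim
  rw [hbot]
  exact finrank_bot _ _
end

section
/- Let m ≥ 1 and let J be the 2m × 2m matrix over GF(2) given in block form by J = [[0, I_m],[I_m, 0]] (i.e. J_{ij} = 1 iff {i,j} = {k, k+m} for some k ∈ {1,…,m}). Then for every column vector a ∈ GF(2)^{2m}, the matrix J + a·aᵀ is invertible over GF(2). -/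
theorem aux_unit {n : Type*} [Fintype n] [DecidableEq n] (J : Matrix n n (ZMod 2)) (a : n → ZMod 2)
    (hJ : J * J = 1) (ha : a ⬝ᵥ (J.mulVec a) = 0) : IsUnit (J + Matrix.vecMulVec a a) := by
  have h0 : Matrix.vecMulVec a a * J * Matrix.vecMulVec a a = 0 := by
    rw [Matrix.mul_assoc, Matrix.mul_vecMulVec, Matrix.vecMulVec_mul_vecMulVec, ha]
    simp
  have h2 : ∀ X : Matrix n n (ZMod 2), X + X = 0 := by
    intro X; ext i j; exact CharTwo.add_self_eq_zero _
  set P := Matrix.vecMulVec a a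
  have h : (J + P) * (J + J * P * J) = 1 := by
    have e : (J + P) * (J + J * P * J) = J * J + (J * J) * P * J + P * J + (P * J * P) * J := by
      noncomm_ring
    rw [e, h0, hJ, Matrix.one_mul, Matrix.zero_mul, add_zero, add_assoc, h2, add_zero]
  exact (Matrix.isUnit_iff_isUnit_det _).2 (Matrix.isUnit_det_of_right_inverse h)

theorem aux_J (m : ℕ) : (Matrix.of fun i j : Fin (m + m) =>
          if (i : ℕ) + m = (j : ℕ) ∨ (j : ℕ) + m = (i : ℕ) then (1 : ZMod 2) else 0)
    = (Matrix.fromBlocks 0 1 1 0 : Matrix (Fin m ⊕ Fin m) (Fin m ⊕ Fin m) (ZMod 2)).submatrix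
      finSumFinEquiv.symm finSumFinEquiv.symm := by
  ext i j
  obtain ⟨i, rfl⟩ := finSumFinEquiv.surjective i
  obtain ⟨j, rfl⟩ := finSumFinEquiv.surjective j
  rcases i with i | i <;> rcases j with j | j <;>
    have hi := i.isLt <;> have hj := j.isLt <;>
    simp only [Matrix.submatrix_apply, Equiv.symm_apply_apply, Matrix.fromBlocks_apply₁₁,
      Matrix.fromBlocks_apply₁₂, Matrix.fromBlocks_apply₂₁, Matrix.fromBlocks_apply₂₂,
      Matrix.of_apply, Matrix.one_apply, Matrix.zero_apply, Fin.ext_iff,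
      finSumFinEquiv_apply_left, finSumFinEquiv_apply_right,
      finSumFinEquiv_symm_apply_castAdd, finSumFinEquiv_symm_apply_natAdd, Fin.val_castAdd, Fin.val_natAdd] <;>
    grind

/-- Let `m ≥ 1` and let `J` be the `2m × 2m` matrix over `GF(2)` given in block form by
`J = [[0, I_m], [I_m, 0]]` (i.e. `J_{ij} = 1` iff `{i,j} = {k, k+m}` for some
`k ∈ {1,…,m}`). Then for every column vector `a ∈ GF(2)^{2m}`, the matrix `J + a·aᵀ` is
invertible over `GF(2)`. -/
theorem statement14 (m : ℕ) (hm : 1 ≤ m) (a : Fin (m + m) → ZMod 2) :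
    IsUnit
      ((Matrix.of fun i j : Fin (m + m) =>
          if (i : ℕ) + m = (j : ℕ) ∨ (j : ℕ) + m = (i : ℕ) then (1 : ZMod 2) else 0)
        + Matrix.vecMulVec a a) := by
  apply aux_unit
  · rw [aux_J, Matrix.submatrix_mul_equiv, Matrix.fromBlocks_multiply]
    simp
  · rw [aux_J, Matrix.submatrix_mulVec_equiv, Matrix.fromBlocks_mulVec]
    simp only [dotProduct, Fin.sum_univ_add]
    simp [Function.comp_def, mul_comm, -Fin.natAdd_eq_addNat]
    exact CharTwo.add_self_eq_zero _
end

section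
/- Let V be a linear subspace of GF(2)^E with a basis v_1, …, v_{2m} satisfying ⟨v_i, v_j⟩ = 1 if {i,j} = {k, k+m} for some k ∈ {1,…,m}, and ⟨v_i, v_j⟩ = 0 otherwise. Then for every x ∈ GF(2)^E, the vector π(x) := ∑_{k=1}^{m} (⟨v_{k+m}, x⟩·v_k + ⟨v_k, x⟩·v_{k+m}) lies in V and x − π(x) lies in V⊥. (Hence π is the orthogonal projection onto the pedestrian space V, with matrix Q_V = ∑_{k=1}^{m} (v_k v_{k+m}ᵀ + v_{k+m} v_kᵀ).) -/
open Finset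

attribute [local instance] Classical.propDecidable

variable {E : Type*}

/-- If `v_1, …, v_{2m}` is an alternating basis of `V`
(`⟨v_i, v_j⟩ = 1` iff `{i,j} = {k, k+m}` for some `k ∈ {1,…,m}`), then for every
`x ∈ GF(2)^E`, the vector `π(x) = ∑_{k=1}^m (⟨v_{k+m}, x⟩ • v_k + ⟨v_k, x⟩ • v_{k+m})`
lies in `V` and `x - π(x)` lies in `V⊥`. -/
theorem statement17 [Fintype E] (V : Submodule (ZMod 2) (E → ZMod 2))
    (m : ℕ) (v : Fin (m + m) → E → ZMod 2)
    (hli : LinearIndependent (ZMod 2) v)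
    (hsp : Submodule.span (ZMod 2) (Set.range v) = V)
    (halt : ∀ i j : Fin (m + m),
      bilin (v i) (v j) =
        if (i : ℕ) + m = (j : ℕ) ∨ (j : ℕ) + m = (i : ℕ) then 1 else 0) :
    ∀ x : E → ZMod 2,
      (∑ k : Fin m,
        (bilin (v (k.addNat m)) x • v (k.castAdd m)
          + bilin (v (k.castAdd m)) x • v (k.addNat m))) ∈ V ∧
      (x - ∑ k : Fin m,
        (bilin (v (k.addNat m)) x • v (k.castAdd m)
          + bilin (v (k.castAdd m)) x • v (k.addNat m))) ∈ perp V := by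
  have hb : ∀ x y : E → ZMod 2, bilin x y = x ⬝ᵥ y := fun _ _ => rfl
  intro x
  subst hsp
  refine ⟨Submodule.sum_mem _ fun k _ => Submodule.add_mem _
    (Submodule.smul_mem _ _ (Submodule.subset_span ⟨_, rfl⟩))
    (Submodule.smul_mem _ _ (Submodule.subset_span ⟨_, rfl⟩)), ?_⟩
  intro w hw
  induction hw using Submodule.span_induction with
  | zero => simp [hb]
  | add a b _ _ ha hb' => rw [hb] at *; rw [dotProduct_add, ha, hb', add_zero]
  | smul c a _ ha => rw [hb] at *; rw [dotProduct_smul, ha, smul_zero]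
  | mem w hw =>
    obtain ⟨i, rfl⟩ := hw
    have key : ∀ k : Fin m,
        bilin (bilin (v (k.addNat m)) x • v (k.castAdd m)
          + bilin (v (k.castAdd m)) x • v (k.addNat m)) (v i)
        = bilin (v (k.addNat m)) x * bilin (v (k.castAdd m)) (v i)
          + bilin (v (k.castAdd m)) x * bilin (v (k.addNat m)) (v i) := by
      intro k
      rw [hb (_ + _), add_dotProduct, smul_dotProduct, smul_dotProduct]
      rfl
    rw [hb, sub_dotProduct, sum_dotProduct, sub_eq_zero]
    simp only [← hb, key, halt]
    have hi := i.isLt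
    by_cases h : (i : ℕ) < m
    · rw [Finset.sum_eq_single (⟨i, h⟩ : Fin m)]
      · have e : Fin.castAdd m (⟨i, h⟩ : Fin m) = i := by ext; simp
        rw [e]
        have hm : m ≠ 0 := by omega
        simp [hb, dotProduct_comm, hm]
      · intro k _ hk
        have hk' : (k : ℕ) ≠ i := fun h' => hk (Fin.ext h')
        have := k.isLt
        rw [if_neg, if_neg] <;> simp <;> omega
      · simp
    · have h2 : (i : ℕ) - m < m := by omega
      rw [Finset.sum_eq_single (⟨i - m, h2⟩ : Fin m)]
      · have e : Fin.addNat (⟨i - m, h2⟩ : Fin m) m = i := by ext; simp; omega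
        rw [e, if_pos, if_neg]
        · simp [hb, dotProduct_comm]
        · omega
        · simp; omega
      · intro k _ hk
        have hk' : (k : ℕ) ≠ i - m := fun h' => hk (Fin.ext h')
        have := k.isLt
        rw [if_neg, if_neg] <;> simp <;> omega
      · simp
end

section
/- Let V ⊆ GF(2)^E and V' ⊆ GF(2)^{E'} be pedestrian linear subspaces (V ∩ V⊥ = 0 and V' ∩ V'⊥ = 0), and let π_V and π_{V'} be the unique linear projections with π_V(x) ∈ V, x − π_V(x) ∈ V⊥ for all x (and analogously for V'). Then the binary matroids M(V) and M(V') are isomorphic — i.e. there is a bijection φ : E → E' such that for every F ⊆ E, F contains the support of some nonzero vector of V if and only if φ(F) contains the support of some nonzero vector of V' — if and only if the support graphs G_V and G_{V'} are isomorphic, i.e. there is a bijection ψ : E → E' such that for all e, f ∈ E: π_V(δ_f)(e) ≠ 0 if and only if π_{V'}(δ_{ψ(f)})(ψ(e)) ≠ 0, where δ_f denotes the standard unit vector supported on f. -/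
open Finset

attribute [local instance] Classical.propDecidable

variable {E : Type*}

theorem mem_supp_iff' {E : Type*} [Fintype E] (x : E → ZMod 2) (e : E) :
    e ∈ supp x ↔ x e ≠ 0 := by simp [supp]

theorem z2_eq_one {a : ZMod 2} (h : a ≠ 0) : a = 1 := by
  revert h; revert a; decide

/-- If the dependent sets agree, then one space is contained in the other. -/
theorem le_of_dep {E : Type*} [Fintype E] (V W : Submodule (ZMod 2) (E → ZMod 2))
    (h : ∀ F : Set E, (∃ v ∈ V, v ≠ 0 ∧ ↑(supp v) ⊆ F) ↔ (∃ w ∈ W, w ≠ 0 ∧ ↑(supp w) ⊆ F)) :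
    V ≤ W := by
  have key : ∀ n : ℕ, ∀ v ∈ V, (supp v).card = n → v ∈ W := by
    intro n
    induction n using Nat.strong_induction_on with
    | _ n ih =>
      intro v hv hn
      by_cases hv0 : v = 0
      · rw [hv0]; exact W.zero_mem
      obtain ⟨w, hw, hw0, hwv⟩ := (h (supp v)).1 ⟨v, hv, hv0, subset_rfl⟩
      rw [Finset.coe_subset] at hwv
      by_cases hs : supp v ⊆ supp w
      · have : v = w := by
          funext e
          by_cases he : v e = 0
          · by_cases he' : w e = 0
            · rw [he, he']
            · exact absurd he ((mem_supp_iff' v e).1 (hwv ((mem_supp_iff' w e).2 he')))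
          · rw [z2_eq_one he, z2_eq_one ((mem_supp_iff' w e).1 (hs ((mem_supp_iff' v e).2 he)))]
        rw [this]; exact hw
      · obtain ⟨u, hu, hu0, huw⟩ := (h (supp w)).2 ⟨w, hw, hw0, subset_rfl⟩
        rw [Finset.coe_subset] at huw
        have h1 : (supp u).card < n := by
          rw [← hn]
          exact Finset.card_lt_card
            (Finset.ssubset_of_subset_of_ssubset huw ⟨hwv, hs⟩)
        have huv := huw.trans hwv
        have h2 : (supp (v - u)).card < n := by
          rw [← hn]
          obtain ⟨e, he⟩ : ∃ e, u e ≠ 0 := by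
            by_contra hc
            push Not at hc
            exact hu0 (funext hc)
          have hve := (mem_supp_iff' v e).1 (huv ((mem_supp_iff' u e).2 he))
          apply Finset.card_lt_card
          rw [Finset.ssubset_iff_of_subset]
          · refine ⟨e, (mem_supp_iff' v e).2 hve, ?_⟩
            rw [mem_supp_iff', not_not, Pi.sub_apply, z2_eq_one he, z2_eq_one hve, sub_self]
          · intro x hx
            rw [mem_supp_iff', Pi.sub_apply] at hx
            by_contra hc
            have hc' : x ∉ supp u := fun h => hc (huv h)
            rw [mem_supp_iff', not_not] at hc hc'
            rw [hc, hc', sub_self] at hx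
            exact hx rfl
        have := W.add_mem (ih _ h2 (v - u) (V.sub_mem hv hu) rfl) (ih _ h1 u hu rfl)
        simpa using this
  exact fun v hv => key _ v hv rfl

theorem proj_unique {E : Type*} [Fintype E] (V : Submodule (ZMod 2) (E → ZMod 2))
    (hped : V ⊓ perp V = ⊥) {x a b : E → ZMod 2} (ha : a ∈ V) (ha' : x - a ∈ perp V)
    (hb : b ∈ V) (hb' : x - b ∈ perp V) : a = b := by
  have h1 : a - b ∈ V ⊓ perp V := by
    refine ⟨V.sub_mem ha hb, ?_⟩
    have := (perp V).sub_mem hb' ha'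
    simpa using this
  rw [hped, Submodule.mem_bot] at h1
  exact sub_eq_zero.1 h1

theorem mem_iff_proj {E : Type*} [Fintype E] (V : Submodule (ZMod 2) (E → ZMod 2))
    (hped : V ⊓ perp V = ⊥) (p : (E → ZMod 2) →ₗ[ZMod 2] (E → ZMod 2))
    (hp : ∀ x, p x ∈ V ∧ x - p x ∈ perp V) (x : E → ZMod 2) : x ∈ V ↔ p x = x := by
  constructor
  · intro hx
    exact proj_unique V hped (hp x).1 (hp x).2 hx (by rw [sub_self]; exact (perp V).zero_mem)
  · intro hx
    rw [← hx]; exact (hp x).1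

theorem supp_subset_image {E E' : Type*} [Fintype E] [Fintype E'] (φ : E ≃ E')
    (w : E → ZMod 2) (F : Set E) :
    (↑(supp (w ∘ φ.symm)) : Set E') ⊆ φ '' F ↔ (↑(supp w) : Set E) ⊆ F := by
  constructor
  · intro h e he
    have : φ e ∈ φ '' F := h (by
      rw [Finset.mem_coe, mem_supp_iff'] at he ⊢
      simpa using he)
    simpa using this
  · intro h e he
    refine ⟨φ.symm e, h ?_, by simp⟩
    rw [Finset.mem_coe, mem_supp_iff'] at he ⊢
    simpa using he

theorem dep_transport {E E' : Type*} [Fintype E] [Fintype E'] (φ : E ≃ E')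
    (V' : Submodule (ZMod 2) (E' → ZMod 2)) (F : Set E) :
    (∃ v' ∈ V', v' ≠ 0 ∧ ↑(supp v') ⊆ φ '' F) ↔
    (∃ w ∈ V'.comap (LinearMap.funLeft (ZMod 2) (ZMod 2) φ.symm), w ≠ 0 ∧ ↑(supp w) ⊆ F) := by
  constructor
  · rintro ⟨v, hv, hv0, hs⟩
    have hvv : (v ∘ φ) ∘ φ.symm = v := by funext x; simp
    refine ⟨v ∘ φ, ?_, ?_, ?_⟩
    · change (v ∘ φ) ∘ φ.symm ∈ V'
      rwa [hvv]
    · intro h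
      rw [h] at hvv
      exact hv0 hvv.symm
    · rw [← supp_subset_image φ, hvv]; exact hs
  · rintro ⟨w, hw, hw0, hs⟩
    refine ⟨w ∘ φ.symm, hw, ?_, (supp_subset_image φ w F).2 hs⟩
    intro h
    apply hw0
    funext x
    simpa using congrFun h (φ x)

theorem single_comp {E E' : Type*} [DecidableEq E] [DecidableEq E'] (φ : E ≃ E') (f : E) :
    (Pi.single f 1 : E → ZMod 2) ∘ φ.symm = Pi.single (φ f) 1 := by
  funext x
  simp [Pi.single_apply, Equiv.symm_apply_eq]

/-- Let `V ⊆ GF(2)^E`, `V' ⊆ GF(2)^{E'}` be pedestrian spaces with orthogonal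
projections `π_V`, `π_{V'}`. Then the binary matroids `M(V)` and `M(V')` are isomorphic
(there is a bijection `φ : E → E'` such that a set `F ⊆ E` contains the support of a
nonzero vector of `V` iff `φ(F)` contains the support of a nonzero vector of `V'`) iff
the support graphs `G_V` and `G_{V'}` are isomorphic (there is a bijection `ψ : E → E'`
with `π_V(δ_f)(e) ≠ 0 ↔ π_{V'}(δ_{ψ f})(ψ e) ≠ 0` for all `e, f`). -/
theorem statement18 {E E' : Type*} [Fintype E] [DecidableEq E] [Fintype E'] [DecidableEq E']
    (V : Submodule (ZMod 2) (E → ZMod 2)) (V' : Submodule (ZMod 2) (E' → ZMod 2))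
    (hped : V ⊓ perp V = ⊥) (hped' : V' ⊓ perp V' = ⊥)
    (πV : (E → ZMod 2) →ₗ[ZMod 2] (E → ZMod 2))
    (πV' : (E' → ZMod 2) →ₗ[ZMod 2] (E' → ZMod 2))
    (hπV : ∀ x, πV x ∈ V ∧ x - πV x ∈ perp V)
    (hπV' : ∀ x, πV' x ∈ V' ∧ x - πV' x ∈ perp V') :
    (∃ φ : E ≃ E', ∀ F : Set E,
        (∃ v ∈ V, v ≠ 0 ∧ ↑(supp v) ⊆ F) ↔
        (∃ v' ∈ V', v' ≠ 0 ∧ ↑(supp v') ⊆ φ '' F)) ↔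
    (∃ ψ : E ≃ E', ∀ e f : E,
        πV (Pi.single f 1) e ≠ 0 ↔ πV' (Pi.single (ψ f) 1) (ψ e) ≠ 0) := by
  constructor
  · rintro ⟨φ, h⟩
    have hdep : ∀ F : Set E, (∃ v ∈ V, v ≠ 0 ∧ ↑(supp v) ⊆ F) ↔
        (∃ w ∈ V'.comap (LinearMap.funLeft (ZMod 2) (ZMod 2) φ.symm), w ≠ 0 ∧ ↑(supp w) ⊆ F) :=
      fun F => (h F).trans (dep_transport φ V' F)
    have hVW := le_antisymm (le_of_dep _ _ hdep) (le_of_dep _ _ fun F => (hdep F).symm)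
    have hmem : ∀ w, w ∈ V ↔ w ∘ φ.symm ∈ V' := fun w => by
      constructor
      · intro hw; rw [hVW] at hw; exact hw
      · intro hw; rw [hVW]; exact hw
    have hcomm : ∀ x, πV' (x ∘ φ.symm) = (πV x) ∘ φ.symm := by
      intro x
      refine proj_unique V' hped' (hπV' _).1 (hπV' _).2 ((hmem _).1 (hπV x).1) ?_
      intro v hv
      have hvv : (v ∘ φ) ∘ φ.symm = v := by funext x; simp
      have h0 : bilin (x - πV x) (v ∘ φ) = 0 :=
        (hπV x).2 (v ∘ φ) ((hmem _).2 (by rw [hvv]; exact hv))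
      rw [← h0]
      unfold bilin
      rw [← Equiv.sum_comp φ]
      simp
    refine ⟨φ, fun e f => ?_⟩
    rw [← single_comp φ f, hcomm]
    simp
  · rintro ⟨ψ, h⟩
    refine ⟨ψ, fun F => ?_⟩
    rw [dep_transport]
    have hcomm : πV' ∘ₗ LinearMap.funLeft (ZMod 2) (ZMod 2) ψ.symm =
        LinearMap.funLeft (ZMod 2) (ZMod 2) ψ.symm ∘ₗ πV := by
      apply LinearMap.pi_ext'
      intro f
      apply LinearMap.ext_ring
      funext x
      change πV' ((Pi.single f 1 : E → ZMod 2) ∘ ψ.symm) x = πV (Pi.single f 1) (ψ.symm x)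
      rw [single_comp]
      have h1 := h (ψ.symm x) f
      rw [Equiv.apply_symm_apply] at h1
      by_cases hx : πV (Pi.single f 1) (ψ.symm x) = 0
      · rw [hx]
        by_contra hc
        exact h1.2 hc hx
      · rw [z2_eq_one hx, z2_eq_one (h1.1 hx)]
    have hVW : V = V'.comap (LinearMap.funLeft (ZMod 2) (ZMod 2) ψ.symm) := by
      ext w
      rw [Submodule.mem_comap, mem_iff_proj V hped πV hπV, mem_iff_proj V' hped' πV' hπV']
      have := LinearMap.congr_fun hcomm w
      simp only [LinearMap.comp_apply] at this
      rw [this]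
      exact (LinearMap.funLeft_injective_of_surjective _ _ _ ψ.symm.surjective).eq_iff.symm
    rw [← hVW]
end
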